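/- For every ε > 0 there exists a swap Schelling game (G,b,1/2) on a bipartite graph G and a strategy profile σ* such that for every swap equilibrium σ of the game, DoI(σ*)/DoI(σ) > 2 − ε; i.e., the Price of Stability on bipartite graphs with peak Λ = 1/2 is at least 2. -/

import Mathlib

open Finset

namespace SwapSchelling

variable {V : Type*} [Fintype V] [DecidableEq V]

open scoped Classical in
/-- The closed neighborhood `N[v]` of a node `v` in `G`, as a `Finset`. -/
noncomputable def closedNbhd (G : SimpleGraph V) (v : V) : Finset V :=
  univ.filter (fun u => u = v ∨ G.Adj v u)

open scoped Classical in
/-- The degree `δ(v)` of a node `v` in `G`. -/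
noncomputable def deg (G : SimpleGraph V) (v : V) : ℕ :=
  (univ.filter (fun u => G.Adj v u)).card

/-- The maximum degree `Δ(G)`. -/
noncomputable def maxDeg (G : SimpleGraph V) : ℕ := univ.sup (deg G)

/-- The minimum degree `δ(G)`. -/
noncomputable def minDeg (G : SimpleGraph V) : ℕ := sInf (Set.range (deg G))

open scoped Classical in
/-- `frac G c v` is the fraction of nodes in the closed neighborhood of `v` that have
the same color as `v` (that is, `f_i(σ)` for the agent `i` occupying node `v`). -/
noncomputable def frac (G : SimpleGraph V) (c : V → Bool) (v : V) : ℝ :=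
  (((closedNbhd G v).filter (fun u => c u = c v)).card : ℝ) / ((closedNbhd G v).card : ℝ)

/-- The coloring obtained from `c` after the agents on nodes `v` and `w` swap positions. -/
def swapColor (c : V → Bool) (v w : V) : V → Bool := c ∘ Equiv.swap v w

/-- A single-peaked utility function `p` with peak at `Λ`: `p 0 = 0`, `p` is strictly
increasing on `[0,Λ]`, `p Λ = 1`, and `p x = p (Λ(1-x)/(1-Λ))` for `x ∈ [Λ,1]`. -/
structure IsSinglePeaked (p : ℝ → ℝ) (Λ : ℝ) : Prop where
  peak_mem : Λ ∈ Set.Ioo (0 : ℝ) 1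
  map_zero : p 0 = 0
  strictMonoOn : StrictMonoOn p (Set.Icc 0 Λ)
  map_peak : p Λ = 1
  symm : ∀ x ∈ Set.Icc Λ 1, p x = p (Λ * (1 - x) / (1 - Λ))

/-- A strategy profile: a 2-coloring of the nodes with exactly `b` blue (`true`) nodes. -/
def IsProfile (c : V → Bool) (b : ℕ) : Prop :=
  (univ.filter (fun v => c v = true)).card = b

/-- The structural data of a swap Schelling game `(G, b, Λ)` with utility function `p`:
`G` is connected, there are `b` blue agents with `1 ≤ b ≤ n/2`, and `p` is a
single-peaked utility function with peak `Λ`. -/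
structure IsGame (G : SimpleGraph V) (b : ℕ) (Λ : ℝ) (p : ℝ → ℝ) : Prop where
  connected : G.Connected
  one_le_b : 1 ≤ b
  b_le_half : 2 * b ≤ Fintype.card V
  singlePeaked : IsSinglePeaked p Λ

/-- The swap of the two (differently colored) agents occupying nodes `v` and `w`
is profitable: both agents strictly increase their utility. -/
def ProfitableSwap (G : SimpleGraph V) (p : ℝ → ℝ) (c : V → Bool) (v w : V) : Prop :=
  c v ≠ c w ∧
  p (frac G (swapColor c v w) w) > p (frac G c v) ∧
  p (frac G (swapColor c v w) v) > p (frac G c w)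

/-- A swap equilibrium: no profitable swap exists. -/
def IsSwapEquilibrium (G : SimpleGraph V) (p : ℝ → ℝ) (c : V → Bool) : Prop :=
  ∀ v w, ¬ ProfitableSwap G p c v w

open scoped Classical in
/-- The degree of integration: the number of non-segregated agents. -/
noncomputable def DoI (G : SimpleGraph V) (c : V → Bool) : ℕ :=
  (univ.filter (fun v => frac G c v ≠ 1)).card

open scoped Classical in
/-- The number of monochromatic edges of `G` under the coloring `c`. -/
noncomputable def Phi (G : SimpleGraph V) (c : V → Bool) : ℕ :=
  (G.edgeFinset.filter (fun e => ∀ u ∈ e, ∀ w ∈ e, c u = c w)).card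

open scoped Classical in
/-- The number of edges of `G`. -/
noncomputable def numEdges (G : SimpleGraph V) : ℕ :=
  (univ.filter (fun e : Sym2 V => e ∈ G.edgeSet)).card

/-- A finset of nodes is an independent set of `G`. -/
def IsIndepSet (G : SimpleGraph V) (s : Finset V) : Prop :=
  ∀ u ∈ s, ∀ w ∈ s, ¬ G.Adj u w

open scoped Classical in
/-- The independence number `α(G)`. -/
noncomputable def indepNum (G : SimpleGraph V) : ℕ :=
  univ.sup (fun s : Finset V => if IsIndepSet G s then s.card else 0)

open scoped Classical in
/-- The degree of `v` inside the subgraph of `G` induced by the node set `s`. -/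
noncomputable def degOn (G : SimpleGraph V) (s : Finset V) (v : V) : ℕ :=
  (s.filter (fun u => G.Adj v u)).card


theorem mem_closedNbhd {G : SimpleGraph V} {u v : V} :
    u ∈ closedNbhd G v ↔ u = v ∨ G.Adj v u := by
  simp [closedNbhd]

theorem card_closedNbhd_pos (G : SimpleGraph V) (v : V) : 0 < #(closedNbhd G v) :=
  card_pos.mpr ⟨v, mem_closedNbhd.mpr (.inl rfl)⟩

theorem frac_pos (G : SimpleGraph V) (c : V → Bool) (v : V) : 0 < frac G c v :=
  div_pos (mod_cast card_pos.mpr ⟨v, by simp [mem_closedNbhd]⟩)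
    (mod_cast card_closedNbhd_pos G v)

theorem frac_le_one (G : SimpleGraph V) (c : V → Bool) (v : V) : frac G c v ≤ 1 :=
  div_le_one_of_le₀ (mod_cast card_filter_le _ _) (Nat.cast_nonneg _)

/-- An agent is segregated iff all its neighbors have its color. -/
theorem frac_eq_one_iff (G : SimpleGraph V) (c : V → Bool) (v : V) :
    frac G c v = 1 ↔ ∀ u, G.Adj v u → c u = c v := by
  have hpos := card_closedNbhd_pos G v
  rw [frac, div_eq_one_iff_eq (by positivity), Nat.cast_inj, card_filter_eq_iff]
  simp only [mem_closedNbhd]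
  constructor
  · exact fun h u hu => h u (.inr hu)
  · rintro h u (rfl | hu)
    exacts [rfl, h u hu]

/-- Every non-segregated agent lies in the closed neighborhood of a blue agent. -/
theorem DoI_le_sum (G : SimpleGraph V) (c : V → Bool) :
    DoI G c ≤ ∑ v with c v = true, #(closedNbhd G v) := by
  refine le_trans (card_le_card fun u hu => ?_) card_biUnion_le
  simp only [mem_filter, mem_univ, true_and, ne_eq, frac_eq_one_iff, not_forall] at hu
  obtain ⟨v, huv, hne⟩ := hu
  simp only [mem_biUnion, mem_filter, mem_univ, true_and, mem_closedNbhd]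
  by_cases hcu : c u = true
  · exact ⟨u, hcu, .inl rfl⟩
  · exact ⟨v, by grind, .inr huv.symm⟩

/-- If both colors occur in a connected graph, some agent is not segregated. -/
theorem DoI_pos {G : SimpleGraph V} (hG : G.Connected) {c : V → Bool} {u v : V}
    (huv : c u ≠ c v) : 0 < DoI G c := by
  by_contra! h
  have hseg : ∀ x, frac G c x = 1 := by simpa [DoI] using h
  obtain ⟨w⟩ := hG.preconnected u v
  refine huv ?_
  clear huv h
  induction w with
  | nil => rfl
  | cons h _ ih => exact ((frac_eq_one_iff G c _).mp (hseg _) _ h).symm.trans ih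

namespace IsSinglePeaked

variable {p : ℝ → ℝ}

theorem map_one (hp : IsSinglePeaked p (1 / 2)) : p 1 = 0 := by
  rw [hp.symm 1 (by norm_num), ← hp.map_zero]
  norm_num

theorem map_one_sub (hp : IsSinglePeaked p (1 / 2)) {x : ℝ} (hx : x ∈ Set.Icc (1 / 2) 1) :
    p x = p (1 - x) := by
  rw [hp.symm x hx]
  congr 1
  ring

theorem pos (hp : IsSinglePeaked p (1 / 2)) {x : ℝ} (h₀ : 0 < x) (h₁ : x < 1) : 0 < p x := by
  rcases le_total x (1 / 2) with h | h
  · simpa [hp.map_zero] using hp.strictMonoOn ⟨le_rfl, by norm_num⟩ ⟨h₀.le, h⟩ h₀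
  · rw [hp.map_one_sub ⟨h, h₁.le⟩, ← hp.map_zero]
    exact hp.strictMonoOn ⟨le_rfl, by norm_num⟩ ⟨by linarith, by linarith⟩ (by linarith)

theorem lt_one (hp : IsSinglePeaked p (1 / 2)) {x : ℝ} (h₀ : 0 ≤ x) (h₁ : x ≤ 1)
    (hx : x ≠ 1 / 2) : p x < 1 := by
  rw [← hp.map_peak]
  rcases hx.lt_or_gt with h | h
  · exact hp.strictMonoOn ⟨h₀, h.le⟩ ⟨by norm_num, le_rfl⟩ h
  · rw [hp.map_one_sub ⟨h.le, h₁⟩]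
    exact hp.strictMonoOn ⟨by linarith, by linarith⟩ ⟨by norm_num, le_rfl⟩ (by linarith)

end IsSinglePeaked

/-- The adjacent hubs `0` and `1` with `k` further neighbors each (the even and the odd nodes
among `2, …, 2k+1`, respectively), and a pendant node `2k+2` attached to `2`. -/
def doubleStar (k : ℕ) : SimpleGraph (Fin (2 * k + 3)) :=
  .fromRel fun u v => (u.val = 0 ∧ v.val = 1) ∨
    (u.val ≤ 1 ∧ 2 ≤ v.val ∧ v.val ≤ 2 * k + 1 ∧ v.val % 2 = u.val) ∨
    (u.val = 2 ∧ v.val = 2 * k + 2)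

/-- The profile in which exactly the two hubs of `doubleStar k` are blue. -/
def hubColoring (k : ℕ) (u : Fin (2 * k + 3)) : Bool := decide (u.val ≤ 1)

section DoubleStar

variable {k : ℕ}

theorem doubleStar_adj {u v : Fin (2 * k + 3)} : (doubleStar k).Adj u v ↔ u.val ≠ v.val ∧
    (((u.val = 0 ∧ v.val = 1) ∨
      (u.val ≤ 1 ∧ 2 ≤ v.val ∧ v.val ≤ 2 * k + 1 ∧ v.val % 2 = u.val) ∨
      (u.val = 2 ∧ v.val = 2 * k + 2)) ∨
    ((v.val = 0 ∧ u.val = 1) ∨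
      (v.val ≤ 1 ∧ 2 ≤ u.val ∧ u.val ≤ 2 * k + 1 ∧ u.val % 2 = v.val) ∨
      (v.val = 2 ∧ u.val = 2 * k + 2))) := by
  simp [doubleStar, SimpleGraph.fromRel_adj, Fin.val_inj]

theorem doubleStar_connected (hk : 1 ≤ k) : (doubleStar k).Connected := by
  rw [SimpleGraph.connected_iff_exists_forall_reachable]
  have h₁ : (doubleStar k).Adj ⟨0, by omega⟩ ⟨1, by omega⟩ := by
    simp [doubleStar_adj]
  have h₂ : (doubleStar k).Adj ⟨0, by omega⟩ ⟨2, by omega⟩ := by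
    rw [doubleStar_adj]
    dsimp only
    omega
  refine ⟨⟨0, by omega⟩, fun v => ?_⟩
  rcases (by omega : v.val = 0 ∨ v.val = 2 * k + 2 ∨
    (1 ≤ v.val ∧ v.val ≤ 2 * k + 1 ∧ (v.val = 1 ∨ v.val % 2 = 0)) ∨
    (2 ≤ v.val ∧ v.val ≤ 2 * k + 1 ∧ v.val % 2 = 1)) with h | h | h | h
  · rw [show v = ⟨0, by omega⟩ from Fin.ext h]
  · refine h₂.reachable.trans (SimpleGraph.Adj.reachable ?_)
    rw [doubleStar_adj]
    dsimp only
    omega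
  · refine SimpleGraph.Adj.reachable ?_
    rw [doubleStar_adj]
    dsimp only
    omega
  · refine h₁.reachable.trans (SimpleGraph.Adj.reachable ?_)
    rw [doubleStar_adj]
    dsimp only
    omega

theorem doubleStar_colorable (k : ℕ) : (doubleStar k).Colorable 2 := by
  refine ⟨.mk (fun v => if v.val = 0 ∨ v.val = 2 * k + 2 ∨ (v.val ≠ 1 ∧ v.val % 2 = 1)
    then 0 else 1) fun {u v} h => ?_⟩
  rw [doubleStar_adj] at h
  split_ifs <;> first | decide | omega

theorem card_closedNbhd_doubleStar_le_three {v : Fin (2 * k + 3)} (hv : 2 ≤ v.val) :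
    #(closedNbhd (doubleStar k) v) ≤ 3 := by
  refine (card_le_card (t := {v, ⟨v.val % 2, by omega⟩,
    if v.val = 2 then ⟨2 * k + 2, by omega⟩ else ⟨2 % (2 * k + 3), Nat.mod_lt _ (by omega)⟩})
    fun u hu => ?_).trans card_le_three
  rw [mem_closedNbhd, doubleStar_adj] at hu
  simp only [mem_insert, mem_singleton, Fin.ext_iff, apply_ite Fin.val] at hu ⊢
  have : 2 % (2 * k + 3) = 2 := Nat.mod_eq_of_lt (by omega)
  split_ifs <;> omega

theorem card_closedNbhd_doubleStar_le (hk : 1 ≤ k) (v : Fin (2 * k + 3)) :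
    #(closedNbhd (doubleStar k) v) ≤ k + 2 := by
  by_cases hv : 2 ≤ v.val
  · exact (card_closedNbhd_doubleStar_le_three hv).trans (by omega)
  rw [← card_range (k + 2)]
  refine card_le_card_of_injOn (fun u => if u.val ≤ 1 then u.val else u.val / 2 + 1) ?_ ?_
  · intro u hu
    rw [mem_coe, mem_closedNbhd, doubleStar_adj, Fin.ext_iff] at hu
    simp only [coe_range, Set.mem_Iio]
    split_ifs <;> omega
  · intro u hu w hw huw
    rw [mem_coe, mem_closedNbhd, doubleStar_adj, Fin.ext_iff] at hu hw
    rw [Fin.ext_iff]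
    dsimp only at huw
    split_ifs at huw <;> omega

theorem hubColoring_isProfile (k : ℕ) : IsProfile (hubColoring k) 2 := by
  have : ({v | hubColoring k v = true} : Finset (Fin (2 * k + 3))) =
      {⟨0, by omega⟩, ⟨1, by omega⟩} := by
    ext v
    simp only [hubColoring, mem_filter, mem_univ, true_and, decide_eq_true_eq, mem_insert,
      mem_singleton, Fin.ext_iff]
    omega
  rw [IsProfile, this, card_pair (by simp)]

theorem le_DoI_hubColoring (hk : 1 ≤ k) : 2 * k + 2 ≤ DoI (doubleStar k) (hubColoring k) := by
  have hcard : #(univ.erase (Fin.last (2 * k + 2))) = 2 * k + 2 := by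
    simp
  refine hcard.symm.le.trans (card_le_card fun v hv => ?_)
  have hv' : v.val ≠ 2 * k + 2 := by simpa [Fin.ext_iff] using hv
  simp only [mem_filter, mem_univ, true_and, ne_eq, frac_eq_one_iff, not_forall]
  by_cases hv₁ : v.val ≤ 1
  · refine ⟨⟨v.val + 2, by omega⟩, ?_, ?_⟩
    · rw [doubleStar_adj]
      dsimp only
      omega
    · simp [hubColoring, hv₁]
  · refine ⟨⟨v.val % 2, by omega⟩, ?_, ?_⟩
    · rw [doubleStar_adj]
      dsimp only
      omega
    · simp [hubColoring, hv₁]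
      omega

/-- The fraction of blue agents around hub `0` of `doubleStar k` misses the peak. -/
theorem frac_hubColoring_zero_ne (hk : 3 ≤ k) :
    frac (doubleStar k) (hubColoring k) ⟨0, by omega⟩ ≠ 1 / 2 := by
  have hnum : #{u ∈ closedNbhd (doubleStar k) ⟨0, by omega⟩ |
      hubColoring k u = hubColoring k ⟨0, by omega⟩} ≤ 2 := by
    refine (card_le_card fun u hu => ?_).trans (hubColoring_isProfile k).le
    simp_all [hubColoring]
  have hden : 4 < #(closedNbhd (doubleStar k) ⟨0, by omega⟩) := by
    refine lt_of_lt_of_le (b := #({⟨0, by omega⟩, ⟨1, by omega⟩, ⟨2, by omega⟩, ⟨4, by omega⟩,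
      ⟨6, by omega⟩} : Finset (Fin (2 * k + 3)))) ?_ (card_le_card fun u hu => ?_)
    · simp [card_insert_of_notMem]
    · simp only [mem_insert, mem_singleton, Fin.ext_iff] at hu
      rw [mem_closedNbhd, doubleStar_adj, Fin.ext_iff]
      dsimp only
      omega
  refine ne_of_lt ?_
  rw [frac, div_lt_div_iff₀ ?_ two_pos]
  · norm_cast
    omega
  · exact mod_cast card_closedNbhd_pos _ _

/-- The blue agent on hub `0` and the red agent on the pendant node profit from swapping. -/
theorem profitableSwap_hubColoring (hk : 3 ≤ k) {p : ℝ → ℝ} (hp : IsSinglePeaked p (1 / 2)) :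
    ProfitableSwap (doubleStar k) p (hubColoring k) ⟨0, by omega⟩ (Fin.last _) := by
  have hlast : frac (doubleStar k) (hubColoring k) (Fin.last _) = 1 := by
    rw [frac_eq_one_iff]
    intro u hu
    rw [doubleStar_adj, Fin.val_last] at hu
    simp only [hubColoring, Fin.val_last, decide_eq_decide]
    omega
  have hlast' : frac (doubleStar k) (swapColor (hubColoring k) ⟨0, by omega⟩ (Fin.last _))
      (Fin.last _) = 1 / 2 := by
    have hne : (⟨2, by omega⟩ : Fin (2 * k + 3)) ≠ Fin.last _ := by
      rw [ne_eq, Fin.ext_iff, Fin.val_last]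
      dsimp only
      omega
    have hnbhd : closedNbhd (doubleStar k) (Fin.last _) = {⟨2, by omega⟩, Fin.last _} := by
      ext u
      simp only [mem_closedNbhd, doubleStar_adj, mem_insert, mem_singleton, Fin.ext_iff,
        Fin.val_last, and_true]
      omega
    have h₂ : swapColor (hubColoring k) ⟨0, by omega⟩ (Fin.last _) ⟨2, by omega⟩ = false := by
      rw [swapColor, Function.comp_apply, Equiv.swap_apply_of_ne_of_ne (by simp) hne]
      simp [hubColoring]
    have hl : swapColor (hubColoring k) ⟨0, by omega⟩ (Fin.last _) (Fin.last _) = true := by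
      simp [swapColor, hubColoring]
    rw [frac, hnbhd, card_pair hne, filter_insert, filter_singleton]
    simp only [h₂, hl]
    norm_num
  have hzero : frac (doubleStar k) (swapColor (hubColoring k) ⟨0, by omega⟩ (Fin.last _))
      ⟨0, by omega⟩ ≠ 1 := by
    rw [ne_eq, frac_eq_one_iff]
    intro h
    have := h ⟨1, by omega⟩ (by simp [doubleStar_adj])
    rw [swapColor, Function.comp_apply, Function.comp_apply, Equiv.swap_apply_left,
      Equiv.swap_apply_of_ne_of_ne (by simp) (by simp [Fin.ext_iff])] at this
    simp [hubColoring] at this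
  refine ⟨by simp [hubColoring], ?_, ?_⟩
  · rw [hlast', hp.map_peak]
    exact hp.lt_one (frac_pos _ _ _).le (frac_le_one _ _ _) (frac_hubColoring_zero_ne hk)
  · rw [hlast, hp.map_one]
    exact hp.pos (frac_pos _ _ _) ((frac_le_one _ _ _).lt_of_ne hzero)

end DoubleStar

/-- For every `ε > 0` there is a game on a bipartite graph with peak `1/2`
and a strategy profile `σ*` such that every swap equilibrium `σ` satisfies
`DoI(σ*)/DoI(σ) > 2 - ε` (Price of Stability ≥ 2 on bipartite graphs). -/
theorem price_of_stability_bipartite_lower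
    (ε : ℝ) (hε : 0 < ε) (p : ℝ → ℝ) (hp : IsSinglePeaked p (1 / 2)) :
    ∃ (n : ℕ) (G : SimpleGraph (Fin n)) (b : ℕ),
      IsGame G b (1 / 2) p ∧ G.Colorable 2 ∧
      ∃ cstar : Fin n → Bool, IsProfile cstar b ∧
        ∀ c : Fin n → Bool, IsProfile c b → IsSwapEquilibrium G p c →
          2 - ε < (DoI G cstar : ℝ) / (DoI G c : ℝ) := by
  obtain ⟨m, hm⟩ := exists_nat_gt (8 / ε)
  obtain ⟨k, hk, hmk⟩ : ∃ k, 3 ≤ k ∧ m ≤ k := ⟨max 3 m, le_max_left _ _, le_max_right _ _⟩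
  have hconn := doubleStar_connected (k := k) (by omega)
  refine ⟨2 * k + 3, doubleStar k, 2, ⟨hconn, one_le_two, by simp; omega, hp⟩,
    doubleStar_colorable k, hubColoring k, hubColoring_isProfile k, fun c hc hSE => ?_⟩
  obtain ⟨a, b, hab, hblue⟩ := card_eq_two.mp hc
  have hmem (v) : c v = true ↔ v = a ∨ v = b := by
    simpa using congrArg (v ∈ ·) hblue
  have hne : c ≠ hubColoring k := by
    rintro rfl
    exact hSE _ _ (profitableSwap_hubColoring hk hp)
  have hle : DoI (doubleStar k) c ≤ k + 5 := by
    refine (DoI_le_sum _ c).trans ?_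
    rw [hblue, sum_pair hab]
    have ha := card_closedNbhd_doubleStar_le (k := k) (by omega) a
    have hb := card_closedNbhd_doubleStar_le (k := k) (by omega) b
    by_cases ha₂ : 2 ≤ a.val
    · have := card_closedNbhd_doubleStar_le_three ha₂
      omega
    by_cases hb₂ : 2 ≤ b.val
    · have := card_closedNbhd_doubleStar_le_three hb₂
      omega
    refine absurd (funext fun v => ?_) hne
    rw [Bool.eq_iff_iff, hmem, hubColoring, decide_eq_true_eq]
    rw [ne_eq, Fin.ext_iff] at hab
    rw [Fin.ext_iff, Fin.ext_iff]
    omega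
  have hpos : 0 < DoI (doubleStar k) c := by
    obtain ⟨v, hv⟩ : ∃ v, v ∉ ({a, b} : Finset (Fin (2 * k + 3))) := by
      by_contra! h
      have := card_le_card (fun v _ => h v : univ ⊆ _)
      rw [card_pair hab, card_univ, Fintype.card_fin] at this
      omega
    refine DoI_pos hconn (u := a) (v := v) ?_
    rw [(hmem a).mpr (.inl rfl)]
    exact fun h => hv (by simpa using (hmem v).mp h.symm)
  have hstar := le_DoI_hubColoring (k := k) (by omega)
  rify at hle hpos hstar hmk
  rw [lt_div_iff₀ hpos]
  rw [div_lt_iff₀ hε] at hm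
  nlinarith

end SwapSchelling
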